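/- Let n ≥ 6 be even and let P_n be the regular n-gon with unit circumradius. Then A(P_n) = n·tan(π/n) + (n/2)·(sin⁴(π/n)/cos²(π/n))·tan(2π/n). -/

import Mathlib

open MeasureTheory Real

noncomputable section

/-- The plane. -/
abbrev E2 := EuclideanSpace ℝ (Fin 2)

/-- The `k`-th vertex of the regular `n`-gon with unit circumradius. -/
def regVtx (n k : ℕ) : E2 :=
  (WithLp.equiv 2 (Fin 2 → ℝ)).symm ![Real.cos (2 * Real.pi * k / n), Real.sin (2 * Real.pi * k / n)]

/-- The regular `n`-gon with unit circumradius. -/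
def regPoly (n : ℕ) : Set E2 := convexHull ℝ (Set.range fun k : Fin n => regVtx n k)

/-- A convex polygon: the convex hull of a finite set of points. -/
def IsConvexPolygon (Q : Set E2) : Prop := ∃ F : Finset E2, Q = convexHull ℝ (F : Set E2)

/-- The supremum of the areas of convex polygons circumscribed about the regular `n`-gon. -/
def maxCircArea (n : ℕ) : ℝ :=
  sSup {A : ℝ | ∃ Q : Set E2, IsConvexPolygon Q ∧ regPoly n ⊆ Q ∧
    (∀ k : Fin n, regVtx n k ∈ frontier Q) ∧ (volume Q).toReal = A}

theorem tan_le_div_mul_tan {x a : ℝ} (hx : 0 ≤ x) (hxa : x ≤ a) (ha : 0 < a) (ha' : a < π / 2) :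
    tan x ≤ x / a * tan a := by
  have hcos : ∀ y ∈ Set.Ico (0 : ℝ) (π / 2), 0 < cos y := fun y hy =>
    cos_pos_of_mem_Ioo ⟨by linarith [hy.1, pi_pos], hy.2⟩
  have hconv : ConvexOn ℝ (Set.Ico (0 : ℝ) (π / 2)) tan := by
    refine MonotoneOn.convexOn_of_deriv (convex_Ico _ _)
      (fun y hy => (continuousAt_tan.2 (hcos y hy).ne').continuousWithinAt)
      (fun y hy => (differentiableAt_tan.2
        (hcos y (interior_subset hy)).ne').differentiableWithinAt) ?_
    intro y hy z hz hyz
    rw [Real.deriv_tan, Real.deriv_tan]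
    have hz' := interior_subset hz
    have hy' := interior_subset hy
    have h1 := hcos z hz'
    have h2 : cos z ≤ cos y :=
      cos_le_cos_of_nonneg_of_le_pi hy'.1 (by linarith [hz'.2, pi_pos]) hyz
    gcongr
  have h := hconv.2 ⟨le_rfl, by positivity⟩ ⟨ha.le, ha'⟩
    (sub_nonneg.2 ((div_le_one ha).2 hxa)) (by positivity) (sub_add_cancel 1 (x / a))
  simpa [div_mul_cancel₀ x ha.ne'] using h

theorem two_mul_cot_le_cot_add_cot {A B : ℝ} (hA : 0 < A) (hB : 0 < B) (hAB : A + B ≤ π) :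
    2 * (cos ((A + B) / 2) / sin ((A + B) / 2)) ≤ cos A / sin A + cos B / sin B := by
  have hsA : 0 < sin A := sin_pos_of_pos_of_lt_pi hA (by linarith)
  have hsB : 0 < sin B := sin_pos_of_pos_of_lt_pi hB (by linarith)
  have hsm : 0 < sin ((A + B) / 2) := sin_pos_of_pos_of_lt_pi (by linarith) (by linarith)
  have hcm : 0 ≤ cos ((A + B) / 2) := cos_nonneg_of_mem_Icc ⟨by linarith, by linarith⟩
  have h1 : sin A * sin B ≤ sin ((A + B) / 2) ^ 2 := by
    have h2 := cos_sub A B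
    have h3 := cos_add A B
    have h4 : cos (A + B) = 1 - 2 * sin ((A + B) / 2) ^ 2 := by
      rw [show A + B = 2 * ((A + B) / 2) by ring, cos_two_mul, cos_sq']
      ring_nf
    nlinarith [cos_le_one (A - B)]
  have h5 : cos A / sin A + cos B / sin B
      = 2 * cos ((A + B) / 2) * sin ((A + B) / 2) / (sin A * sin B) := by
    have h6 : sin (A + B) = 2 * sin ((A + B) / 2) * cos ((A + B) / 2) := by
      rw [← sin_two_mul]
      ring_nf
    rw [div_add_div _ _ hsA.ne' hsB.ne', mul_right_comm, ← h6, sin_add]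
    ring
  rw [h5, le_div_iff₀ (by positivity), mul_div_assoc', div_mul_eq_mul_div, div_le_iff₀ hsm]
  nlinarith [mul_le_mul_of_nonneg_left h1 hcm]

theorem setLIntegral_ofReal_affine {a b p q : ℝ} (hab : a ≤ b)
    (hpos : ∀ x ∈ Set.Icc a b, 0 ≤ p + q * x) :
    ∫⁻ x in Set.Icc a b, ENNReal.ofReal (p + q * x)
      = ENNReal.ofReal (p * (b - a) + q * (b ^ 2 - a ^ 2) / 2) := by
  rw [← ofReal_integral_eq_lintegral_ofReal
    ((by fun_prop : Continuous fun x : ℝ => p + q * x).continuousOn.integrableOn_Icc)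
    ((ae_restrict_iff' measurableSet_Icc).2 (Filter.Eventually.of_forall hpos)),
    integral_Icc_eq_integral_Ioc, ← intervalIntegral.integral_of_le hab,
    intervalIntegral.integral_add (by simp)
      ((by fun_prop : Continuous fun x : ℝ => q * x).intervalIntegrable _ _),
    intervalIntegral.integral_const_mul, integral_id, intervalIntegral.integral_const]
  congr 1
  simp only [smul_eq_mul]
  ring

theorem volume_complex_eq_lintegral {S : Set ℂ} (hS : MeasurableSet S) :
    volume S = ∫⁻ x : ℝ, volume {y : ℝ | (⟨x, y⟩ : ℂ) ∈ S} := by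
  have h := Complex.volume_preserving_equiv_real_prod.symm.measure_preimage_equiv S
  rw [← h, Measure.volume_eq_prod,
    Measure.prod_apply (Complex.measurableEquivRealProd.symm.measurable hS)]
  rfl


theorem volume_wedge_inter_halfPlanes_le {h A B : ℝ} (hh : 0 < h) (hh' : h ≤ π / 6)
    (hA : 0 ≤ A) (hA' : A ≤ 2 * h) (hB : 0 ≤ B) (hB' : B ≤ 2 * h) :
    volume {z : ℂ | |z.im| ≤ z.re * tan h ∧ z.re * cos B + z.im * sin B ≤ cos (h - B) ∧
      z.re * cos A - z.im * sin A ≤ cos (h - A)} ≤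
      ENNReal.ofReal (sin h * cos h + sin h ^ 2 * tan ((A + B) / 2)) := by
  have hπ := pi_pos
  set m := (A + B) / 2 with hm
  have hm0 : 0 ≤ m := by positivity
  have hm1 : m ≤ π / 3 := by linarith
  have hc : 0 < cos h := cos_pos_of_mem_Ioo ⟨by linarith, by linarith⟩
  have hs : 0 < sin h := sin_pos_of_pos_of_lt_pi hh (by linarith)
  have ht : 0 < tan h := tan_pos_of_pos_of_lt_pi_div_two hh (by linarith)
  have hcm : 0 < cos m := cos_pos_of_mem_Ioo ⟨by linarith, by linarith⟩
  have hsm : 0 ≤ sin m := sin_nonneg_of_nonneg_of_le_pi hm0 (by linarith)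
  have htm : 0 ≤ tan m := tan_nonneg_of_nonneg_of_le_pi_div_two hm0 (by linarith)
  have hcot : 0 ≤ cos m / sin m := by positivity
  have hct : cos m / sin m * tan m ≤ 1 := by
    rw [tan_eq_sin_div_cos, div_mul_div_comm, mul_comm]
    exact div_self_le_one _
  have hmeas : MeasurableSet {z : ℂ | |z.im| ≤ z.re * tan h ∧
      z.re * cos B + z.im * sin B ≤ cos (h - B) ∧ z.re * cos A - z.im * sin A ≤ cos (h - A)} := by
    have h1 : IsClosed {z : ℂ | |z.im| ≤ z.re * tan h} :=
      isClosed_le (by fun_prop) (by fun_prop)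
    have h2 : IsClosed {z : ℂ | z.re * cos B + z.im * sin B ≤ cos (h - B)} :=
      isClosed_le (by fun_prop) (by fun_prop)
    have h3 : IsClosed {z : ℂ | z.re * cos A - z.im * sin A ≤ cos (h - A)} :=
      isClosed_le (by fun_prop) (by fun_prop)
    exact (h1.inter (h2.inter h3)).measurableSet
  rw [volume_complex_eq_lintegral hmeas]
  let g₁ : ℝ → ENNReal := fun x => ENNReal.ofReal (0 + 2 * tan h * x)
  let g₂ : ℝ → ENNReal := fun x =>
    ENNReal.ofReal ((2 * sin h + 2 * cos h * (cos m / sin m)) + -(2 * (cos m / sin m)) * x)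
  calc
    _ ≤ ∫⁻ x : ℝ, ((Set.Icc 0 (cos h)).indicator g₁ x +
        (Set.Icc (cos h) (cos h + sin h * tan m)).indicator g₂ x) := by
      refine lintegral_mono fun x => ?_
      simp only [Set.mem_ofPred_eq]
      rcases lt_or_ge x 0 with hx | hx
      · have : {y : ℝ | |y| ≤ x * tan h ∧ x * cos B + y * sin B ≤ cos (h - B) ∧
            x * cos A - y * sin A ≤ cos (h - A)} = ∅ := by
          ext y
          simp only [Set.mem_ofPred_eq, Set.mem_empty_iff_false, iff_false]
          rintro ⟨h1, -⟩
          nlinarith [abs_nonneg y]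
        rw [this, measure_empty]
        exact zero_le
      rcases le_or_gt x (cos h) with hx1 | hx1
      · refine le_trans ?_ le_self_add
        rw [Set.indicator_of_mem (Set.mem_Icc.2 ⟨hx, hx1⟩)]
        calc _ ≤ volume (Set.Icc (-(x * tan h)) (x * tan h)) :=
              measure_mono fun y hy => abs_le.1 hy.1
          _ = g₁ x := by
              rw [Real.volume_Icc]
              congr 1
              ring
      · refine le_trans ?_ le_add_self
        rcases Set.eq_empty_or_nonempty {y : ℝ | |y| ≤ x * tan h ∧
            x * cos B + y * sin B ≤ cos (h - B) ∧ x * cos A - y * sin A ≤ cos (h - A)}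
          with he | ⟨y₀, -, hy₀B, hy₀A⟩
        · rw [he, measure_empty]
          exact zero_le
        have hA0 : 0 < A := by
          refine hA.lt_of_ne fun h0 => ?_
          subst h0
          simp at hy₀A
          linarith
        have hB0 : 0 < B := by
          refine hB.lt_of_ne fun h0 => ?_
          subst h0
          simp at hy₀B
          linarith
        have hsA : 0 < sin A := sin_pos_of_pos_of_lt_pi hA0 (by linarith)
        have hsB : 0 < sin B := sin_pos_of_pos_of_lt_pi hB0 (by linarith)
        have hsm : 0 < sin m := sin_pos_of_pos_of_lt_pi (by positivity) (by linarith)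
        have hle_B : ∀ y, x * cos B + y * sin B ≤ cos (h - B) →
            y ≤ sin h - (x - cos h) * (cos B / sin B) := by
          intro y hy
          rw [cos_sub] at hy
          rw [le_sub_iff_add_le, mul_div_assoc', ← le_sub_iff_add_le', div_le_iff₀ hsB]
          linarith
        have hle_A : ∀ y, x * cos A - y * sin A ≤ cos (h - A) →
            -y ≤ sin h - (x - cos h) * (cos A / sin A) := by
          intro y hy
          rw [cos_sub] at hy
          rw [le_sub_iff_add_le, mul_div_assoc', ← le_sub_iff_add_le', div_le_iff₀ hsA]
          linarith
        have hcots := mul_le_mul_of_nonneg_left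
          (two_mul_cot_le_cot_add_cot hA0 hB0 (by linarith)) (sub_nonneg.2 hx1.le)
        rw [← hm] at hcots
        have hxle : x ≤ cos h + sin h * tan m := by
          have h1 : (x - cos h) * (cos m / sin m) ≤ sin h := by
            linarith [hle_A y₀ hy₀A, hle_B y₀ hy₀B]
          rw [mul_div_assoc', div_le_iff₀ hsm, ← le_div_iff₀ hcm, mul_div_assoc,
            ← tan_eq_sin_div_cos] at h1
          linarith
        rw [Set.indicator_of_mem (Set.mem_Icc.2 ⟨hx1.le, hxle⟩)]
        calc _ ≤ volume (Set.Icc (-(sin h - (x - cos h) * (cos A / sin A)))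
                (sin h - (x - cos h) * (cos B / sin B))) :=
              measure_mono fun y hy => ⟨neg_le.1 (hle_A y hy.2.2), hle_B y hy.2.1⟩
          _ ≤ g₂ x := by
              rw [Real.volume_Icc]
              refine ENNReal.ofReal_le_ofReal ?_
              linarith
    _ = ENNReal.ofReal (0 * (cos h - 0) + 2 * tan h * (cos h ^ 2 - 0 ^ 2) / 2) +
        ENNReal.ofReal ((2 * sin h + 2 * cos h * (cos m / sin m)) * (cos h + sin h * tan m - cos h)
          + -(2 * (cos m / sin m)) * ((cos h + sin h * tan m) ^ 2 - cos h ^ 2) / 2) := by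
      rw [lintegral_add_left (by
          refine Measurable.indicator ?_ measurableSet_Icc
          fun_prop), lintegral_indicator measurableSet_Icc, lintegral_indicator measurableSet_Icc,
        setLIntegral_ofReal_affine hc.le, setLIntegral_ofReal_affine]
      · nlinarith
      · intro x hx
        have := mul_le_mul_of_nonneg_left hx.2 hcot
        nlinarith
      · intro x hx
        have := hx.1
        positivity
    _ = _ := by
      have h1 : tan h * cos h = sin h := tan_mul_cos hc.ne'
      have h2 : cos m / sin m * tan m * tan m = tan m := by
        rcases hsm.eq_or_lt with h0 | h0
        · simp [tan_eq_sin_div_cos, ← h0]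
        · rw [tan_eq_sin_div_cos]
          field_simp
      rw [← ENNReal.ofReal_add (by ring_nf; positivity)]
      · congr 1
        linear_combination cos h * h1 - sin h ^ 2 * h2
      · have h3 := mul_le_mul_of_nonneg_left hct (by positivity : 0 ≤ sin h ^ 2 * tan m)
        have h4 : 0 ≤ sin h ^ 2 * tan m := by positivity
        linarith
theorem Convex.exists_re_mul_conj_le {Q : Set ℂ} (hQ : Convex ℝ Q) (hne : (interior Q).Nonempty)
    {v : ℂ} (hv : v ∉ interior Q) :
    ∃ c : ℂ, c ≠ 0 ∧ ∀ z ∈ Q, (z * (starRingEnd ℂ) c).re ≤ (v * (starRingEnd ℂ) c).re := by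
  obtain ⟨f, hf⟩ := geometric_hahn_banach_open_point hQ.interior isOpen_interior hv
  have hf' : ∀ z, f z = (z * (starRingEnd ℂ) ⟨f 1, f Complex.I⟩).re := by
    intro z
    have hz : z = z.re • (1 : ℂ) + z.im • Complex.I := by
      simp
    conv_lhs => rw [hz, map_add, map_smul, map_smul]
    simp
  refine ⟨⟨f 1, f Complex.I⟩, fun h0 => ?_, fun z hz => ?_⟩
  · obtain ⟨a, ha⟩ := hne
    have := hf a ha
    rw [hf' a, hf' v, h0] at this
    simp at this
  · rw [← hf', ← hf']
    have hz' : z ∈ closure (interior Q) := by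
      rw [hQ.closure_interior_eq_closure_of_nonempty_interior hne]
      exact subset_closure hz
    exact closure_minimal (fun a ha => (hf a ha).le : interior Q ⊆ {a | f a ≤ f v})
      (isClosed_le f.continuous continuous_const) hz'

theorem abs_le_of_cos_add_le_of_cos_sub_le {α h : ℝ} (hh : 0 < h) (hh' : h < π / 2)
    (hα : α ∈ Set.Ioc (-π) π) (h1 : cos (α + 2 * h) ≤ cos α) (h2 : cos (α - 2 * h) ≤ cos α) :
    |α| ≤ h := by
  have hs : 0 < sin h := sin_pos_of_pos_of_lt_pi hh (by linarith)
  have h3 : 0 ≤ sin (α + h) := by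
    have := cos_sub_cos α (α + 2 * h)
    rw [show (α + (α + 2 * h)) / 2 = α + h by ring,
      show (α - (α + 2 * h)) / 2 = -h by ring, sin_neg] at this
    nlinarith
  have h4 : sin (α - h) ≤ 0 := by
    have := cos_sub_cos α (α - 2 * h)
    rw [show (α + (α - 2 * h)) / 2 = α - h by ring,
      show (α - (α - 2 * h)) / 2 = h by ring] at this
    nlinarith
  rw [abs_le]
  constructor
  · by_contra! hc
    have : 0 < sin (-(α + h)) :=
      sin_pos_of_pos_of_lt_pi (by linarith) (by linarith [hα.1])
    rw [sin_neg] at this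
    linarith
  · by_contra! hc
    have : 0 < sin (α - h) := sin_pos_of_pos_of_lt_pi (by linarith) (by linarith [hα.2])
    linarith

/-- The point of the unit circle at angle `θ`. -/
def cis (θ : ℝ) : ℂ := ⟨cos θ, sin θ⟩

theorem cis_eq_exp (θ : ℝ) : cis θ = Complex.exp (θ * Complex.I) := by
  apply Complex.ext <;> simp [cis, Complex.exp_ofReal_mul_I_re, Complex.exp_ofReal_mul_I_im]

theorem re_cis (θ : ℝ) : (cis θ).re = cos θ := rfl

theorem im_cis (θ : ℝ) : (cis θ).im = sin θ := rfl

theorem cis_add (a b : ℝ) : cis (a + b) = cis a * cis b := by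
  simp [cis_eq_exp, add_mul, Complex.exp_add]

theorem cis_mul_cis_neg (a : ℝ) : cis a * cis (-a) = 1 := by
  rw [← cis_add]; simp [cis_eq_exp]

theorem conj_cis (a : ℝ) : (starRingEnd ℂ) (cis a) = cis (-a) := by
  apply Complex.ext <;> simp [cis]

theorem cis_add_nat_mul_two_pi (a : ℝ) (k : ℕ) : cis (a + k * (2 * π)) = cis a := by
  simp [cis]

theorem cis_add_int_mul_two_pi (a : ℝ) (k : ℤ) : cis (a + k * (2 * π)) = cis a := by
  simp [cis]

theorem volume_preimage_mul_cis (θ : ℝ) (S : Set ℂ) :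
    volume ((fun z : ℂ => z * cis θ) ⁻¹' S) = volume S := by
  have h := (rotation (Circle.exp θ)).measurePreserving
  have h2 := MeasurePreserving.measure_preimage_equiv
    (f := (rotation (Circle.exp θ)).toHomeomorph.toMeasurableEquiv) h S
  rw [← h2]
  congr 1
  ext z
  simp [cis_eq_exp, mul_comm]

theorem exists_mul_cis_mem_wedge {n : ℕ} (hn : 3 ≤ n) (z : ℂ) :
    ∃ k < n, |(z * cis (-((2 * k + 1) * (π / n)))).im| ≤
      (z * cis (-((2 * k + 1) * (π / n)))).re * tan (π / n) := by
  have hn0 : (0 : ℝ) < n := by positivity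
  have hn3 : (3 : ℝ) ≤ n := by exact_mod_cast hn
  have hπ := pi_pos
  set h := π / n with hh
  have hh0 : 0 < h := by positivity
  have hnh : n * h = π := by rw [hh]; field_simp
  have hlt : h < π / 2 := by nlinarith
  obtain ⟨θ, hθ0, hθ1, hz⟩ : ∃ θ, 0 ≤ θ ∧ θ < 2 * π ∧ z = ‖z‖ * cis θ := by
    have hz := Complex.norm_mul_exp_arg_mul_I z
    rw [← cis_eq_exp] at hz
    rcases lt_or_ge z.arg 0 with h0 | h0
    · refine ⟨z.arg + (1 : ℕ) * (2 * π), ?_, ?_, ?_⟩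
      · push_cast
        linarith [Complex.neg_pi_lt_arg z]
      · push_cast
        linarith
      · rw [cis_add_nat_mul_two_pi, hz]
    · exact ⟨z.arg, h0, by linarith [Complex.arg_le_pi z], hz.symm⟩
  have hq0 : 0 ≤ θ / (2 * h) := by positivity
  have hk1 := Nat.floor_le hq0
  have hk2 := Nat.lt_floor_add_one (θ / (2 * h))
  rw [le_div_iff₀ (by positivity)] at hk1
  rw [div_lt_iff₀ (by positivity)] at hk2
  refine ⟨⌊θ / (2 * h)⌋₊, ?_, ?_⟩
  · rw [Nat.floor_lt hq0, div_lt_iff₀ (by positivity)]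
    linarith
  · generalize (⌊θ / (2 * h)⌋₊ : ℝ) = k at hk1 hk2
    have hw : z * cis (-((2 * k + 1) * h)) = ‖z‖ * cis (θ - (2 * k + 1) * h) := by
      conv_lhs => rw [hz]
      rw [mul_assoc, ← cis_add, sub_eq_add_neg]
    rw [hw]
    set t := θ - (2 * k + 1) * h
    have ht : |t| ≤ h := abs_le.2 ⟨by simp only [t]; linarith, by simp only [t]; linarith⟩
    have hct : 0 < cos |t| := cos_pos_of_mem_Ioo ⟨by linarith [abs_nonneg t], by linarith⟩
    have htan : tan |t| ≤ tan h := by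
      refine strictMonoOn_tan.monotoneOn ⟨by linarith [abs_nonneg t], by linarith⟩
        ⟨by linarith, by linarith⟩ ht
    have habs : |sin t| = sin |t| := by
      rcases abs_cases t with ⟨h1, h2⟩ | ⟨h1, h2⟩
      · rw [h1, abs_of_nonneg (sin_nonneg_of_nonneg_of_le_pi h2 (by linarith))]
      · rw [h1, sin_neg, abs_of_nonpos (sin_nonpos_of_nonpos_of_neg_pi_le h2.le (by linarith))]
    simp only [Complex.mul_im, Complex.mul_re, Complex.ofReal_re, Complex.ofReal_im, zero_mul,
      add_zero, sub_zero, cis]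
    rw [abs_mul, abs_norm, habs, mul_assoc]
    refine mul_le_mul_of_nonneg_left ?_ (norm_nonneg z)
    rw [← cos_abs t, ← tan_mul_cos hct.ne', mul_comm]
    gcongr

theorem Convex.exists_abs_le_of_cis_mem_frontier {Q : Set ℂ} (hQ : Convex ℝ Q)
    (hne : (interior Q).Nonempty) {φ h : ℝ} (hh : 0 < h) (hh' : h < π / 2)
    (hφ : cis φ ∈ frontier Q) (hφ₁ : cis (φ + 2 * h) ∈ Q) (hφ₂ : cis (φ - 2 * h) ∈ Q) :
    ∃ α, |α| ≤ h ∧ ∀ z ∈ Q, (z * (cis (-φ) * cis (-α))).re ≤ cos α := by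
  obtain ⟨c, hc0, hc⟩ := hQ.exists_re_mul_conj_le hne hφ.2
  set α := (c * cis (-φ)).arg with hα
  have hc' : (starRingEnd ℂ) c = ‖c‖ * (cis (-φ) * cis (-α)) := by
    have h1 := Complex.norm_mul_exp_arg_mul_I (c * cis (-φ))
    rw [← hα, ← cis_eq_exp, norm_mul, cis_eq_exp (-φ), Complex.norm_exp_ofReal_mul_I, mul_one,
      ← cis_eq_exp] at h1
    have h2 : c = ‖c‖ * (cis φ * cis α) := by
      rw [mul_left_comm, h1, mul_left_comm, cis_mul_cis_neg, mul_one]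
    conv_lhs => rw [h2]
    simp [conj_cis]
  have hle : ∀ z ∈ Q, (z * (cis (-φ) * cis (-α))).re ≤ cos α := by
    intro z hz
    have h1 := hc z hz
    rw [hc', mul_left_comm, mul_left_comm (cis φ), Complex.re_ofReal_mul, Complex.re_ofReal_mul,
      mul_le_mul_iff_right₀ (norm_pos_iff.2 hc0), ← mul_assoc (cis φ), cis_mul_cis_neg, one_mul] at h1
    simpa [cis] using h1
  refine ⟨α, abs_le_of_cos_add_le_of_cos_sub_le hh hh'
    ⟨Complex.neg_pi_lt_arg _, Complex.arg_le_pi _⟩ ?_ ?_, hle⟩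
  · have h1 := hle _ hφ₂
    rw [← cis_add, ← cis_add, show φ - 2 * h + (-φ + -α) = -(α + 2 * h) by ring, re_cis, cos_neg] at h1
    exact h1
  · have h1 := hle _ hφ₁
    rw [← cis_add, ← cis_add, show φ + 2 * h + (-φ + -α) = -(α - 2 * h) by ring, re_cis, cos_neg] at h1
    exact h1

theorem Convex.volume_le_of_cis_mem_frontier {n : ℕ} (hn : 6 ≤ n) {Q : Set ℂ} (hQ : Convex ℝ Q)
    (hmem : ∀ k < n, cis (2 * k * (π / n)) ∈ Q)
    (hfr : ∀ k < n, cis (2 * k * (π / n)) ∈ frontier Q) :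
    volume Q ≤ ENNReal.ofReal (n * (sin (π / n) * cos (π / n)) +
      n / 2 * sin (π / n) ^ 2 * tan (2 * (π / n))) := by
  rcases Set.eq_empty_or_nonempty (interior Q) with he | hne
  · have h1 : volume (closure Q) = 0 := by
      rw [closure_eq_interior_union_frontier, he, Set.empty_union]
      exact hQ.addHaar_frontier volume
    rw [measure_mono_null subset_closure h1]
    exact zero_le
  have hn0 : (0 : ℝ) < n := by positivity
  have hn6 : (6 : ℝ) ≤ n := by exact_mod_cast hn
  have hπ := pi_pos
  set h := π / n with hh
  have hh0 : 0 < h := by positivity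
  have hnh : n * h = π := by rw [hh]; field_simp
  have hle : h ≤ π / 6 := by nlinarith
  have hred : ∀ k : ℤ, ∃ l < n, cis (2 * k * h) = cis (2 * l * h) := by
    intro k
    have hn0' : (n : ℤ) ≠ 0 := by positivity
    have h1 := Int.emod_nonneg k hn0'
    have h2 := Int.emod_lt_of_pos k (by positivity : 0 < (n : ℤ))
    refine ⟨(k % n).toNat, by omega, ?_⟩
    have h3 : (((k % n).toNat : ℕ) : ℝ) = ((k % n : ℤ) : ℝ) := by
      exact_mod_cast Int.toNat_of_nonneg h1
    have h4 : (k : ℝ) = n * ((k / n : ℤ) : ℝ) + ((k % n : ℤ) : ℝ) := by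
      exact_mod_cast (Int.mul_ediv_add_emod k n).symm
    rw [h3, ← cis_add_int_mul_two_pi (2 * ((k % n : ℤ) : ℝ) * h) (k / n), ← hnh]
    congr 1
    rw [h4]
    ring
  have hmem' : ∀ k : ℤ, cis (2 * k * h) ∈ Q := fun k => by
    obtain ⟨l, hl, he⟩ := hred k
    exact he ▸ hmem l hl
  have hfr' : ∀ k : ℤ, cis (2 * k * h) ∈ frontier Q := fun k => by
    obtain ⟨l, hl, he⟩ := hred k
    exact he ▸ hfr l hl
  have hsupp : ∀ v : ℂ, (∃ k : ℤ, v = cis (2 * k * h)) →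
      ∃ α, |α| ≤ h ∧ ∀ z ∈ Q, (z * ((starRingEnd ℂ) v * cis (-α))).re ≤ cos α := by
    rintro v ⟨k, rfl⟩
    rw [conj_cis]
    refine hQ.exists_abs_le_of_cis_mem_frontier hne hh0 (by linarith) (hfr' k) ?_ ?_
    · convert hmem' (k + 1) using 2
      push_cast
      ring
    · convert hmem' (k - 1) using 2
      push_cast
      ring
  choose! f hf using hsupp
  set a : ℕ → ℝ := fun k => f (cis (2 * k * h)) with ha
  have ha' : ∀ k : ℕ, |a k| ≤ h ∧ ∀ z ∈ Q, (z * cis (-(2 * k * h) - a k)).re ≤ cos (a k) := by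
    intro k
    have h1 := hf (cis (2 * k * h)) ⟨k, by norm_cast⟩
    rw [conj_cis, ← cis_add] at h1
    exact h1
  have han : a n = a 0 := by
    have h1 := cis_add_nat_mul_two_pi 0 1
    simp only [ha]
    congr 1
    convert h1 using 2
    · push_cast
      linear_combination 2 * hnh
    · simp
  have hs : 0 < sin h := sin_pos_of_pos_of_lt_pi hh0 (by linarith)
  have hc : 0 < cos h := cos_pos_of_mem_Ioo ⟨by linarith, by linarith⟩
  let R : ℕ → Set ℂ := fun k =>
    {z : ℂ | |z.im| ≤ z.re * tan h ∧
      z.re * cos (h + a (k + 1)) + z.im * sin (h + a (k + 1)) ≤ cos (h - (h + a (k + 1))) ∧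
      z.re * cos (h - a k) - z.im * sin (h - a k) ≤ cos (h - (h - a k))}
  have hcover : Q ⊆ ⋃ k ∈ Finset.range n, (fun z => z * cis (-((2 * k + 1) * h))) ⁻¹' R k := by
    intro z hz
    obtain ⟨k, hk, hw⟩ := exists_mul_cis_mem_wedge (by omega : 3 ≤ n) z
    simp only [Set.mem_iUnion, Finset.mem_range, exists_prop]
    refine ⟨k, hk, hw, ?_, ?_⟩
    · have h1 := (ha' (k + 1)).2 z hz
      rw [show -(2 * ((k + 1 : ℕ) : ℝ) * h) - a (k + 1)
        = -((2 * k + 1) * h) + -(h + a (k + 1)) by push_cast; ring, cis_add, ← mul_assoc] at h1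
      rw [show h - (h + a (k + 1)) = -a (k + 1) by ring, cos_neg]
      convert h1 using 1
      rw [Complex.mul_re _ (cis (-(h + a (k + 1)))), re_cis, im_cis, cos_neg, sin_neg, mul_neg,
        sub_neg_eq_add]
    · have h1 := (ha' k).2 z hz
      rw [show -(2 * (k : ℝ) * h) - a k
        = -((2 * k + 1) * h) + (h - a k) by ring, cis_add, ← mul_assoc] at h1
      rw [show h - (h - a k) = a k by ring]
      convert h1 using 1
      rw [Complex.mul_re _ (cis (h - a k)), re_cis, im_cis]
  have htan : ∀ k, tan ((h - a k + (h + a (k + 1))) / 2) ≤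
      (1 / 2 + (a (k + 1) - a k) / (4 * h)) * tan (2 * h) := by
    intro k
    have h1 := abs_le.1 (ha' k).1
    have h2 := abs_le.1 (ha' (k + 1)).1
    refine (tan_le_div_mul_tan (a := 2 * h) (by linarith) (by linarith) (by linarith)
      (by linarith)).trans_eq ?_
    congr 1
    field_simp
    ring
  calc volume Q ≤ _ := measure_mono hcover
    _ ≤ ∑ k ∈ Finset.range n, volume ((fun z => z * cis (-((2 * k + 1) * h))) ⁻¹' R k) :=
      measure_biUnion_finset_le _ _
    _ ≤ ∑ k ∈ Finset.range n, ENNReal.ofReal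
        (sin h * cos h + sin h ^ 2 * tan ((h - a k + (h + a (k + 1))) / 2)) := by
      refine Finset.sum_le_sum fun k _ => ?_
      rw [volume_preimage_mul_cis]
      have h1 := abs_le.1 (ha' k).1
      have h2 := abs_le.1 (ha' (k + 1)).1
      exact volume_wedge_inter_halfPlanes_le hh0 hle (by linarith) (by linarith)
        (by linarith) (by linarith)
    _ = ENNReal.ofReal (∑ k ∈ Finset.range n,
        (sin h * cos h + sin h ^ 2 * tan ((h - a k + (h + a (k + 1))) / 2))) := by
      refine (ENNReal.ofReal_sum_of_nonneg fun k _ => ?_).symm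
      have h1 := abs_le.1 (ha' k).1
      have h2 := abs_le.1 (ha' (k + 1)).1
      have : 0 ≤ tan ((h - a k + (h + a (k + 1))) / 2) :=
        tan_nonneg_of_nonneg_of_le_pi_div_two (by linarith) (by linarith)
      positivity
    _ ≤ _ := by
      refine ENNReal.ofReal_le_ofReal ?_
      calc _ ≤ ∑ k ∈ Finset.range n, (sin h * cos h + sin h ^ 2 *
            ((1 / 2 + (a (k + 1) - a k) / (4 * h)) * tan (2 * h))) := by
            gcongr with k _
            exact htan k
        _ = _ := by
            rw [Finset.sum_add_distrib, ← Finset.mul_sum _ _ (sin h ^ 2), ← Finset.sum_mul _ _ (tan (2 * h)),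
              Finset.sum_add_distrib, ← Finset.sum_div _ _ (4 * h), Finset.sum_range_sub, han]
            simp
            ring

theorem not_mem_interior_of_re_mul_cis_le {Q : Set ℂ} {v : ℂ} {θ b : ℝ}
    (hQ : ∀ z ∈ Q, (z * cis (-θ)).re ≤ b) (hv : (v * cis (-θ)).re = b) : v ∉ interior Q := by
  intro hi
  have h1 : Filter.Tendsto (fun t : ℝ => v + t * cis θ) (nhdsWithin 0 (Set.Ioi 0)) (nhds v) := by
    have h2 : Continuous fun t : ℝ => v + t * cis θ := by fun_prop
    have h3 := h2.tendsto 0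
    simp only [Complex.ofReal_zero, zero_mul, add_zero] at h3
    exact h3.mono_left nhdsWithin_le_nhds
  obtain ⟨t, ht, ht0⟩ :=
    ((h1.eventually (mem_interior_iff_mem_nhds.1 hi)).and self_mem_nhdsWithin).exists
  have h4 := hQ _ ht
  rw [add_mul, mul_assoc, cis_mul_cis_neg, mul_one, Complex.add_re, hv, Complex.ofReal_re] at h4
  exact absurd ht0 (by simpa using h4)

theorem le_volume_triangle {c t : ℝ} (hc : 0 < c) (ht : 0 < t) :
    ENNReal.ofReal (c ^ 2 * t) ≤ volume {z : ℂ | z.re ≤ c ∧ |z.im| < z.re * t} := by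
  have hm1 : MeasurableSet {z : ℂ | z.re ≤ c} :=
    (isClosed_le (by fun_prop) (by fun_prop)).measurableSet
  have hm2 : MeasurableSet {z : ℂ | |z.im| < z.re * t} :=
    (isOpen_lt (by fun_prop) (by fun_prop)).measurableSet
  rw [volume_complex_eq_lintegral (S := {z : ℂ | z.re ≤ c ∧ |z.im| < z.re * t}) (hm1.inter hm2)]
  calc _ = ∫⁻ x in Set.Icc 0 c, ENNReal.ofReal (0 + 2 * t * x) := by
        rw [setLIntegral_ofReal_affine hc.le]
        · congr 1
          ring
        · intro x hx
          have := hx.1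
          positivity
    _ ≤ _ := by
        rw [← lintegral_indicator measurableSet_Icc]
        refine lintegral_mono fun x => ?_
        by_cases hx : x ∈ Set.Icc 0 c
        swap
        · rw [Set.indicator_of_notMem hx]
          exact zero_le
        rw [Set.indicator_of_mem hx]
        calc ENNReal.ofReal (0 + 2 * t * x) = volume (Set.Ioo (-(x * t)) (x * t)) := by
              rw [Real.volume_Ioo]
              congr 1
              ring
          _ ≤ _ := measure_mono fun y hy =>
              (⟨hx.2, abs_lt.2 hy⟩ : x ≤ c ∧ |y| < x * t)

theorem abs_arg_lt_of_abs_im_lt {u : ℂ} {t : ℝ} (ht : 0 < t) (ht' : t < π / 2)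
    (hu : |u.im| < u.re * tan t) : |u.arg| < t := by
  have htan : 0 < tan t := tan_pos_of_pos_of_lt_pi_div_two ht ht'
  have hre : 0 < u.re := pos_of_mul_pos_left ((abs_nonneg _).trans_lt hu) htan.le
  have harg := abs_lt.1 (Complex.abs_arg_lt_pi_div_two_iff.2 (Or.inl hre))
  have h1 : |tan u.arg| < tan t := by
    rw [Complex.tan_arg, abs_div, abs_of_pos hre, div_lt_iff₀ hre, mul_comm]
    exact hu
  rw [abs_lt] at h1 ⊢
  rw [← tan_neg] at h1
  exact ⟨(strictMonoOn_tan.lt_iff_lt ⟨by linarith, by linarith⟩ harg).1 h1.1,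
    (strictMonoOn_tan.lt_iff_lt harg ⟨by linarith, by linarith⟩).1 h1.2⟩

theorem eq_of_mul_cis_mem_wedge {m : ℕ} {h : ℝ} (hh : 0 < h) (hh' : 2 * h < π / 2)
    (hmh : 4 * h * m = 2 * π) {j l : ℕ} (hj : j < m) (hl : l < m) {z : ℂ}
    (h1 : |(z * cis (-((4 * j + 1) * h))).im| < (z * cis (-((4 * j + 1) * h))).re * tan (2 * h))
    (h2 : |(z * cis (-((4 * l + 1) * h))).im| < (z * cis (-((4 * l + 1) * h))).re * tan (2 * h)) :
    j = l := by
  set u := z * cis (-((4 * j + 1) * h)) with hu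
  set u' := z * cis (-((4 * l + 1) * h)) with hu'
  have ha := abs_lt.1 (abs_arg_lt_of_abs_im_lt (by positivity) hh' h1)
  have ha' := abs_lt.1 (abs_arg_lt_of_abs_im_lt (by positivity) hh' h2)
  have hn : ∀ θ, ‖cis θ‖ = 1 := fun θ => by rw [cis_eq_exp, Complex.norm_exp_ofReal_mul_I]
  have hz0 : z ≠ 0 := by
    rintro rfl
    simp [hu] at h1
  have hz : ∀ θ, z = ‖z‖ * cis ((z * cis (-θ)).arg + θ) := by
    intro θ
    have h3 := Complex.norm_mul_exp_arg_mul_I (z * cis (-θ))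
    rw [norm_mul, hn, mul_one, ← cis_eq_exp] at h3
    rw [cis_add, ← mul_assoc, h3, mul_assoc, mul_comm (cis _), cis_mul_cis_neg, mul_one]
  have h3 := (hz ((4 * j + 1) * h)).symm.trans (hz ((4 * l + 1) * h))
  rw [mul_right_inj' (by simpa using hz0), ← hu, ← hu', cis_eq_exp, cis_eq_exp,
    Complex.exp_eq_exp_iff_exists_int] at h3
  obtain ⟨p, hp⟩ := h3
  have h4 : u.arg + (4 * j + 1) * h = u'.arg + (4 * l + 1) * h + p * (2 * π) := by
    have h5 := congrArg Complex.im hp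
    simpa using h5
  rw [← hmh] at h4
  have h6 : (((j - l - p * m : ℤ) : ℝ)) * (4 * h) = u'.arg - u.arg := by
    push_cast
    linarith
  have h7 : ((j - l - p * m : ℤ) : ℝ) < 1 := by
    by_contra! hcon
    nlinarith
  have h8 : (-1 : ℝ) < ((j - l - p * m : ℤ) : ℝ) := by
    by_contra! hcon
    nlinarith
  have h9 : (j - l - p * m : ℤ) < 1 := by exact_mod_cast h7
  have h10 : -1 < (j - l - p * m : ℤ) := by exact_mod_cast h8
  have h11 : (j : ℤ) - l = p * m := by omega
  have hp0 : p = 0 := by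
    by_contra hp0
    rcases lt_or_gt_of_ne hp0 with h | h
    · nlinarith
    · nlinarith
  rw [hp0] at h11
  omega

theorem cos_odd_mul_le {m : ℕ} {h : ℝ} (hh : 0 < h) (hmh : 2 * h * m = π) {j l : ℕ} (hj : j < m)
    (hl : l < m) : cos ((4 * l + 3) * h - (4 * j + 1) * h) ≤ cos (2 * h) := by
  have hj' : (j : ℝ) + 1 ≤ m := by exact_mod_cast hj
  have hl' : (l : ℝ) + 1 ≤ m := by exact_mod_cast hl
  have hj0 : (0 : ℝ) ≤ j := by positivity
  have hl0 : (0 : ℝ) ≤ l := by positivity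
  have h1 := cos_sub_cos ((4 * l + 3) * h - (4 * j + 1) * h) (2 * h)
  rw [show ((4 * l + 3) * h - (4 * j + 1) * h + 2 * h) / 2 = 2 * h * (l - j + 1) by ring,
    show ((4 * l + 3) * h - (4 * j + 1) * h - 2 * h) / 2 = 2 * h * (l - j) by ring] at h1
  suffices 0 ≤ sin (2 * h * (l - j + 1)) * sin (2 * h * (l - j)) by linarith
  rcases le_or_gt j l with hjl | hjl
  · have : (j : ℝ) ≤ l := by exact_mod_cast hjl
    refine mul_nonneg (sin_nonneg_of_nonneg_of_le_pi ?_ ?_) (sin_nonneg_of_nonneg_of_le_pi ?_ ?_)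
    · nlinarith
    · nlinarith
    · nlinarith
    · nlinarith
  · have : (l : ℝ) + 1 ≤ j := by exact_mod_cast hjl
    refine mul_nonneg_of_nonpos_of_nonpos (sin_nonpos_of_nonpos_of_neg_pi_le ?_ ?_)
      (sin_nonpos_of_nonpos_of_neg_pi_le ?_ ?_)
    · nlinarith
    · nlinarith
    · nlinarith
    · nlinarith

/-- The vertices of the regular `m`-gon with inradius `cos (π / (2 * m))` whose side lines contain
alternate sides of the regular `2 * m`-gon inscribed in the unit circle. -/
def altVtx (m : ℕ) (j : ℕ) : ℂ :=
  ((cos (π / (2 * m)) / cos (2 * (π / (2 * m))) : ℝ) : ℂ) * cis ((4 * j + 3) * (π / (2 * m)))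

/-- The regular `m`-gon whose side lines contain alternate sides of the regular `2 * m`-gon
inscribed in the unit circle. -/
def altPoly (m : ℕ) : Set ℂ := convexHull ℝ ((Finset.range m).image (altVtx m) : Finset ℂ)

theorem convex_altPoly (m : ℕ) : Convex ℝ (altPoly m) :=
  convex_convexHull ℝ _

theorem angle_bounds {m : ℕ} (hm : 3 ≤ m) :
    0 < π / (2 * m) ∧ π / (2 * m) ≤ π / 6 ∧ 2 * (π / (2 * m)) * m = π := by
  have hm3 : (3 : ℝ) ≤ m := by exact_mod_cast hm
  have hπ := pi_pos
  refine ⟨by positivity, ?_, by field_simp⟩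
  gcongr
  linarith

theorem altVtx_mem {m j : ℕ} (hj : j < m) : altVtx m j ∈ altPoly m :=
  subset_convexHull ℝ _ (by
    simp only [Finset.coe_image, Finset.coe_range]
    exact ⟨j, hj, rfl⟩)

theorem re_mul_cis_le_of_mem_altPoly {m j : ℕ} (hm : 3 ≤ m) (hj : j < m) {z : ℂ}
    (hz : z ∈ altPoly m) :
    (z * cis (-((4 * j + 1) * (π / (2 * m))))).re ≤ cos (π / (2 * m)) := by
  obtain ⟨hh, hle, hmh⟩ := angle_bounds hm
  have hlin : IsLinearMap ℝ fun z : ℂ => (z * cis (-((4 * j + 1) * (π / (2 * m))))).re :=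
    ⟨fun x y => by simp [add_mul], fun r x => by simp [mul_sub, mul_assoc]⟩
  refine convexHull_min ?_ (convex_halfSpace_le hlin (cos (π / (2 * m)))) hz
  intro w hw
  simp only [Finset.coe_image, Finset.coe_range] at hw
  obtain ⟨l, hl, rfl⟩ := hw
  have h1 := cos_odd_mul_le hh hmh hj hl
  have hc : 0 < cos (π / (2 * m)) := cos_pos_of_mem_Ioo ⟨by linarith, by linarith⟩
  have hc2 : 0 < cos (2 * (π / (2 * m))) := cos_pos_of_mem_Ioo ⟨by linarith, by linarith⟩
  simp only [Set.mem_ofPred_eq, altVtx]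
  rw [mul_assoc, ← cis_add, Complex.re_ofReal_mul, re_cis, ← sub_eq_add_neg,
    div_mul_eq_mul_div, div_le_iff₀ hc2]
  gcongr

theorem cis_mul_mem_altPoly {m j : ℕ} (hm : 3 ≤ m) (hj : j < m) {y : ℝ}
    (hy : |y| ≤ cos (π / (2 * m)) * tan (2 * (π / (2 * m)))) :
    cis ((4 * j + 1) * (π / (2 * m))) * ⟨cos (π / (2 * m)), y⟩ ∈ altPoly m := by
  obtain ⟨hh, hle, hmh⟩ := angle_bounds hm
  have hπ := pi_pos
  have hprev : cos (π / (2 * m)) / cos (2 * (π / (2 * m))) *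
      cis ((4 * j + 1) * (π / (2 * m)) - 2 * (π / (2 * m))) ∈ altPoly m := by
    have hex : ∃ l < m, cis ((4 * j + 1) * (π / (2 * m)) - 2 * (π / (2 * m)))
        = cis ((4 * l + 3) * (π / (2 * m))) := by
      rcases j with _ | j
      · refine ⟨m - 1, by omega, ?_⟩
        rw [← cis_add_nat_mul_two_pi _ 1]
        congr 1
        push_cast [Nat.cast_sub (by omega : 1 ≤ m)]
        linear_combination -2 * hmh
      · refine ⟨j, by omega, ?_⟩
        congr 1
        push_cast
        ring
    obtain ⟨l, hl, he⟩ := hex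
    have h1 := altVtx_mem hl
    rw [altVtx, ← he] at h1
    exact_mod_cast h1
  have hnext : cos (π / (2 * m)) / cos (2 * (π / (2 * m))) *
      cis ((4 * j + 1) * (π / (2 * m)) + 2 * (π / (2 * m))) ∈ altPoly m := by
    have h1 := altVtx_mem hj
    rw [altVtx, show (4 * (j : ℝ) + 3) * (π / (2 * m))
      = (4 * j + 1) * (π / (2 * m)) + 2 * (π / (2 * m)) by ring] at h1
    exact_mod_cast h1
  set h := π / (2 * m)
  have hc : 0 < cos h := cos_pos_of_mem_Ioo ⟨by linarith, by linarith⟩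
  have hc2 : 0 < cos (2 * h) := cos_pos_of_mem_Ioo ⟨by linarith, by linarith⟩
  have ht : 0 < tan (2 * h) := tan_pos_of_pos_of_lt_pi_div_two (by positivity) (by linarith)
  have hT : 0 < cos h * tan (2 * h) := by positivity
  rw [abs_le] at hy
  have hcomb := convex_altPoly m hprev hnext
    (a := (1 - y / (cos h * tan (2 * h))) / 2) (b := (1 + y / (cos h * tan (2 * h))) / 2)
    (by
      have := (div_le_one hT).2 hy.2
      linarith)
    (by
      have := (le_div_iff₀ hT).2 (by linarith : -1 * (cos h * tan (2 * h)) ≤ y)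
      linarith)
    (by ring)
  convert hcomb using 1
  rw [sub_eq_add_neg (_ * h), cis_add, cis_add, mul_left_comm _ (cis _) (cis _),
    mul_left_comm _ (cis _) (cis _), ← mul_smul_comm, ← mul_smul_comm, ← mul_smul_comm,
    ← mul_add]
  congr 1
  have htc : tan (2 * h) * cos (2 * h) = sin (2 * h) := tan_mul_cos hc2.ne'
  apply Complex.ext
  · simp only [← Complex.ofReal_div, Complex.add_re, Complex.smul_re, Complex.re_ofReal_mul,
      re_cis, cos_neg, smul_eq_mul, div_mul_cancel₀ _ hc2.ne']
    field_simp
    ring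
  · simp only [← Complex.ofReal_div, Complex.add_im, Complex.smul_im, Complex.im_ofReal_mul,
      im_cis, sin_neg, smul_eq_mul, ← htc]
    field_simp
    ring

theorem exists_cis_eq_mul {m k : ℕ} (hm : 3 ≤ m) (hk : k < 2 * m) :
    ∃ j < m, ∃ y : ℝ, |y| ≤ cos (π / (2 * m)) * tan (2 * (π / (2 * m))) ∧
      cis (2 * k * (π / (2 * m))) =
        cis ((4 * j + 1) * (π / (2 * m))) * ⟨cos (π / (2 * m)), y⟩ := by
  obtain ⟨hh, hle, hmh⟩ := angle_bounds hm
  have hπ := pi_pos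
  set h := π / (2 * m)
  have hc : 0 < cos h := cos_pos_of_mem_Ioo ⟨by linarith, by linarith⟩
  have hs : 0 < sin h := sin_pos_of_pos_of_lt_pi hh (by linarith)
  have htan : tan h ≤ tan (2 * h) := strictMonoOn_tan.monotoneOn ⟨by linarith, by linarith⟩
    ⟨by linarith, by linarith⟩ (by linarith)
  have hsle : sin h ≤ cos h * tan (2 * h) := by
    rw [← tan_mul_cos hc.ne', mul_comm]
    gcongr
  rcases Nat.even_or_odd' k with ⟨j, rfl | rfl⟩
  · refine ⟨j, by omega, -sin h, by rwa [abs_neg, abs_of_pos hs], ?_⟩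
    have h1 : (⟨cos h, -sin h⟩ : ℂ) = cis (-h) := by simp [cis]
    rw [h1, ← cis_add]
    congr 1
    push_cast
    ring
  · refine ⟨j, by omega, sin h, by rwa [abs_of_pos hs], ?_⟩
    change _ = _ * cis h
    rw [← cis_add]
    congr 1
    push_cast
    ring

theorem cis_mem_altPoly {m k : ℕ} (hm : 3 ≤ m) (hk : k < 2 * m) :
    cis (2 * k * (π / (2 * m))) ∈ altPoly m := by
  obtain ⟨j, hj, y, hy, he⟩ := exists_cis_eq_mul hm hk
  rw [he]
  exact cis_mul_mem_altPoly hm hj hy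

theorem cis_mem_frontier_altPoly {m k : ℕ} (hm : 3 ≤ m) (hk : k < 2 * m) :
    cis (2 * k * (π / (2 * m))) ∈ frontier (altPoly m) := by
  refine ⟨subset_closure (cis_mem_altPoly hm hk), ?_⟩
  obtain ⟨j, hj, y, -, he⟩ := exists_cis_eq_mul hm hk
  refine not_mem_interior_of_re_mul_cis_le
    (fun z hz => re_mul_cis_le_of_mem_altPoly hm hj hz) ?_
  rw [he, mul_right_comm, cis_mul_cis_neg, one_mul]

theorem zero_mem_altPoly {m : ℕ} (hm : 3 ≤ m) : (0 : ℂ) ∈ altPoly m := by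
  obtain ⟨-, -, hmh⟩ := angle_bounds hm
  have h1 := cis_mem_altPoly hm (k := 0) (by omega)
  have h2 := cis_mem_altPoly hm (k := m) (by omega)
  rw [mul_right_comm, hmh] at h2
  have h3 := convex_altPoly m h1 h2
    (a := 1 / 2) (b := 1 / 2) (by norm_num) (by norm_num) (by norm_num)
  convert h3 using 1
  apply Complex.ext <;> simp [cis]

theorem le_volume_altPoly {m : ℕ} (hm : 3 ≤ m) :
    ENNReal.ofReal (m * (cos (π / (2 * m)) ^ 2 * tan (2 * (π / (2 * m))))) ≤
      volume (altPoly m) := by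
  obtain ⟨hh, hle, hmh⟩ := angle_bounds hm
  have hπ := pi_pos
  have hedge := fun (j : ℕ) (hj : j < m) (y : ℝ) => cis_mul_mem_altPoly hm hj (y := y)
  have hzero := zero_mem_altPoly hm
  set h := π / (2 * m)
  have hc : 0 < cos h := cos_pos_of_mem_Ioo ⟨by linarith, by linarith⟩
  have ht : 0 < tan (2 * h) := tan_pos_of_pos_of_lt_pi_div_two (by positivity) (by linarith)
  let T : Set ℂ := {z : ℂ | z.re ≤ cos h ∧ |z.im| < z.re * tan (2 * h)}
  let S : ℕ → Set ℂ := fun j => (fun z => z * cis (-((4 * j + 1) * h))) ⁻¹' T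
  have hT : MeasurableSet T :=
    (isClosed_le (by fun_prop) (by fun_prop) : IsClosed {z : ℂ | z.re ≤ cos h}).measurableSet.inter
      (isOpen_lt (by fun_prop) (by fun_prop) :
        IsOpen {z : ℂ | |z.im| < z.re * tan (2 * h)}).measurableSet
  have hS : ∀ j, MeasurableSet (S j) := fun j =>
    (by fun_prop : Continuous fun z : ℂ => z * cis (-((4 * j + 1) * h))).measurable hT
  have hsub : ⋃ j ∈ Finset.range m, S j ⊆ altPoly m := by
    intro z hz
    simp only [Set.mem_iUnion, Finset.mem_range, exists_prop] at hz
    obtain ⟨j, hj, hz1, hz2⟩ := hz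
    dsimp only at hz1 hz2
    have hz3 : z = cis ((4 * j + 1) * h) * (z * cis (-((4 * j + 1) * h))) := by
      rw [mul_left_comm, cis_mul_cis_neg, mul_one]
    set w := z * cis (-((4 * j + 1) * h))
    have hw : 0 < w.re := pos_of_mul_pos_left ((abs_nonneg _).trans_lt hz2) ht.le
    have hmem := hedge j hj (w.im * (cos h / w.re)) (by
      rw [abs_mul, abs_of_pos (by positivity : 0 < cos h / w.re), mul_div_assoc',
        div_le_iff₀ hw]
      nlinarith)
    have hsm := (convex_altPoly m).smul_mem_of_zero_mem hzero hmem
      (t := w.re / cos h) ⟨by positivity, (div_le_one hc).2 hz1⟩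
    rw [hz3]
    convert hsm using 1
    rw [← mul_smul_comm]
    congr 1
    apply Complex.ext
    · simp only [Complex.smul_re, smul_eq_mul]
      field_simp
    · simp only [Complex.smul_im, smul_eq_mul]
      field_simp
  have hdisj : ((Finset.range m : Finset ℕ) : Set ℕ).PairwiseDisjoint S := by
    intro j hj l hl hjl
    refine Set.disjoint_left.2 fun z hz1 hz2 => hjl ?_
    simp only [Finset.coe_range, Set.mem_Iio] at hj hl
    exact eq_of_mul_cis_mem_wedge hh (by linarith) (by linarith) hj hl hz1.2 hz2.2
  calc ENNReal.ofReal (m * (cos h ^ 2 * tan (2 * h)))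
      = ∑ j ∈ Finset.range m, ENNReal.ofReal (cos h ^ 2 * tan (2 * h)) := by
        rw [Finset.sum_const, Finset.card_range, nsmul_eq_mul,
          ENNReal.ofReal_mul (by positivity), ENNReal.ofReal_natCast]
    _ ≤ ∑ j ∈ Finset.range m, volume (S j) := by
        refine Finset.sum_le_sum fun j _ => ?_
        rw [volume_preimage_mul_cis]
        exact le_volume_triangle hc ht
    _ = volume (⋃ j ∈ Finset.range m, S j) :=
        (measure_biUnion_finset hdisj fun j _ => hS j).symm
    _ ≤ volume (altPoly m) := measure_mono hsub

theorem regVtx_eq (n k : ℕ) :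
    regVtx n k = Complex.orthonormalBasisOneI.repr (cis (2 * k * (π / n))) := by
  ext i
  rw [Complex.orthonormalBasisOneI_repr_apply, re_cis, im_cis,
    show 2 * (k : ℝ) * (π / n) = 2 * π * k / n by ring]
  rfl

theorem preimage_frontier_repr (Q : Set E2) :
    Complex.orthonormalBasisOneI.repr ⁻¹' frontier Q =
      frontier (Complex.orthonormalBasisOneI.repr ⁻¹' Q) :=
  Complex.orthonormalBasisOneI.repr.toHomeomorph.preimage_frontier Q

theorem volume_preimage_repr (Q : Set E2) :
    volume (Complex.orthonormalBasisOneI.repr ⁻¹' Q) = volume Q :=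
  MeasurePreserving.measure_preimage_equiv
    (f := Complex.orthonormalBasisOneI.repr.toHomeomorph.toMeasurableEquiv)
    Complex.orthonormalBasisOneI.repr.measurePreserving Q

theorem toReal_volume_le_of_circumscribed {n : ℕ} (hn : 6 ≤ n) {Q : Set E2}
    (hQ : IsConvexPolygon Q) (hsub : regPoly n ⊆ Q) (hfr : ∀ k : Fin n, regVtx n k ∈ frontier Q) :
    (volume Q).toReal ≤ n * (sin (π / n) * cos (π / n)) +
      n / 2 * sin (π / n) ^ 2 * tan (2 * (π / n)) := by
  have hn6 : (6 : ℝ) ≤ n := by exact_mod_cast hn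
  have hh : 0 < π / n := by positivity
  have hle : π / n ≤ π / 6 := by gcongr
  have hs : 0 < sin (π / n) := sin_pos_of_pos_of_lt_pi hh (by linarith)
  have hc : 0 < cos (π / n) := cos_pos_of_mem_Ioo ⟨by linarith, by linarith⟩
  have ht : 0 < tan (2 * (π / n)) :=
    tan_pos_of_pos_of_lt_pi_div_two (by positivity) (by linarith)
  obtain ⟨F, rfl⟩ := hQ
  refine ENNReal.toReal_le_of_le_ofReal (by positivity) ?_
  rw [← volume_preimage_repr]
  refine Convex.volume_le_of_cis_mem_frontier hn ?_ (fun k hk => ?_) (fun k hk => ?_)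
  · exact (convex_convexHull ℝ _).linear_preimage
      Complex.orthonormalBasisOneI.repr.toLinearEquiv.toLinearMap
  · rw [Set.mem_preimage, ← regVtx_eq]
    exact hsub (subset_convexHull ℝ _ ⟨⟨k, hk⟩, rfl⟩)
  · rw [← preimage_frontier_repr, Set.mem_preimage, ← regVtx_eq]
    exact hfr ⟨k, hk⟩

theorem stmt12 (n : ℕ) (hn : 6 ≤ n) (hpar : Even n) :
    maxCircArea n = n * tan (π / n) +
      (n / 2 : ℝ) * (sin (π / n) ^ 4 / cos (π / n) ^ 2) * tan (2 * π / n) := by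
  obtain ⟨m, rfl⟩ := hpar.two_dvd
  have hm : 3 ≤ m := by omega
  obtain ⟨hh, hle, hmh⟩ := angle_bounds hm
  have hcast : ((2 * m : ℕ) : ℝ) = 2 * m := by push_cast; ring
  have hs : 0 < sin (π / (2 * m)) := sin_pos_of_pos_of_lt_pi hh (by linarith)
  have hc : 0 < cos (π / (2 * m)) := cos_pos_of_mem_Ioo ⟨by linarith, by linarith⟩
  have hc2 : 0 < cos (2 * (π / (2 * m))) := cos_pos_of_mem_Ioo ⟨by linarith, by linarith⟩
  have hsc := sin_sq_add_cos_sq (π / (2 * m))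
  have hval₁ : ((2 * m : ℕ) : ℝ) * tan (π / (2 * m : ℕ)) + ((2 * m : ℕ) / 2 : ℝ) *
      (sin (π / (2 * m : ℕ)) ^ 4 / cos (π / (2 * m : ℕ)) ^ 2) * tan (2 * π / (2 * m : ℕ)) =
      m * (cos (π / (2 * m)) ^ 2 * tan (2 * (π / (2 * m)))) := by
    rw [hcast, mul_div_assoc 2 π, tan_eq_sin_div_cos, tan_eq_sin_div_cos, sin_two_mul]
    rw [cos_two_mul'] at hc2 ⊢
    set s := sin (π / (2 * m))
    set c := cos (π / (2 * m))
    field_simp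
    linear_combination (s ^ 2 - c ^ 2) * hsc
  have hval₂ : ((2 * m : ℕ) : ℝ) * (sin (π / (2 * m : ℕ)) * cos (π / (2 * m : ℕ))) +
      (2 * m : ℕ) / 2 * sin (π / (2 * m : ℕ)) ^ 2 * tan (2 * (π / (2 * m : ℕ))) =
      m * (cos (π / (2 * m)) ^ 2 * tan (2 * (π / (2 * m)))) := by
    rw [hcast, tan_eq_sin_div_cos, sin_two_mul]
    rw [cos_two_mul'] at hc2 ⊢
    set s := sin (π / (2 * m))
    set c := cos (π / (2 * m))
    field_simp
    ring
  rw [hval₁]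
  refine IsGreatest.csSup_eq ⟨?_, ?_⟩
  swap
  · rintro A ⟨Q, hQ, hsub, hfr, rfl⟩
    rw [← hval₂]
    exact toReal_volume_le_of_circumscribed hn hQ hsub hfr
  let Q : Set E2 := Complex.orthonormalBasisOneI.repr '' altPoly m
  have hpre : Complex.orthonormalBasisOneI.repr ⁻¹' Q = altPoly m :=
    Set.preimage_image_eq _ Complex.orthonormalBasisOneI.repr.injective
  have hQ : IsConvexPolygon Q := by
    classical
    refine ⟨((Finset.range m).image (altVtx m)).image Complex.orthonormalBasisOneI.repr, ?_⟩
    rw [Finset.coe_image]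
    exact LinearMap.image_convexHull
      Complex.orthonormalBasisOneI.repr.toLinearEquiv.toLinearMap _
  have hsub : regPoly (2 * m) ⊆ Q := by
    refine convexHull_min ?_ (hQ.choose_spec ▸ convex_convexHull ℝ _)
    rintro _ ⟨k, rfl⟩
    dsimp only
    rw [regVtx_eq, ← Set.mem_preimage, hpre, hcast]
    exact cis_mem_altPoly hm k.2
  have hfr : ∀ k : Fin (2 * m), regVtx (2 * m) k ∈ frontier Q := by
    intro k
    rw [regVtx_eq, ← Set.mem_preimage, preimage_frontier_repr, hpre, hcast]
    exact cis_mem_frontier_altPoly hm k.2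
  refine ⟨Q, hQ, hsub, hfr, le_antisymm ?_ ?_⟩
  · rw [← hval₂]
    exact toReal_volume_le_of_circumscribed hn hQ hsub hfr
  · refine (ENNReal.ofReal_le_iff_le_toReal ?_).1 ?_
    · obtain ⟨F, hF⟩ := hQ
      rw [hF]
      exact (F.finite_toSet.isCompact_convexHull ℝ).measure_ne_top
    · rw [← volume_preimage_repr, hpre]
      exact le_volume_altPoly hm
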